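/- Let 0 < p, q < ∞ with p ≠ q, let r ∈ [0,1], and let (t_n) be a sequence of positive reals such that √n (t_n A_{p,q} − 1) → Φ_{p,q}^{-1}(r) in [−∞,∞], where Φ_{p,q} is the distribution function of a centred Gaussian with variance σ²_{p,q}. Then |𝔻_p^n ∩ t_n 𝔻_q^n| → r as n → ∞. In particular, if t_n ≡ t is constant, then |𝔻_p^n ∩ t 𝔻_q^n| converges to 0 if t < 1/A_{p,q}, to 1/2 if t = 1/A_{p,q}, and to 1 if t > 1/A_{p,q}. -/

import Mathlib

open MeasureTheory Set Filter
open scoped ENNReal Topology Pointwise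

/-- The `q`-norm on `ℝ^n` (for `q ∈ (0,∞)`). -/
noncomputable def pnorm {n : ℕ} (q : ℝ) (x : Fin n → ℝ) : ℝ :=
  (∑ i, |x i| ^ q) ^ (1 / q)

/-- The unit ball `𝔹_p^n`. -/
def pBall (n : ℕ) (p : ℝ) : Set (Fin n → ℝ) := {x | pnorm p x ≤ 1}

/-- The volume-normalized ball `𝔻_p^n = |𝔹_p^n|^{-1/n} 𝔹_p^n`. -/
noncomputable def nBall (n : ℕ) (p : ℝ) : Set (Fin n → ℝ) :=
  ((volume (pBall n p)).toReal ^ (-(1 / (n : ℝ)))) • pBall n p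

/-- `M_p(q)`, the `q`-th absolute moment of the `p`-generalized Gaussian distribution. -/
noncomputable def Mp (p q : ℝ) : ℝ :=
  p ^ (q / p) / (q + 1) * (Real.Gamma (1 + (q + 1) / p) / Real.Gamma (1 + 1 / p))

/-- `m_{p,q} = M_p(q)^{1/q}`. -/
noncomputable def mpq (p q : ℝ) : ℝ := Mp p q ^ (1 / q)

/-- `C_p(q,r) = M_p(q+r) − M_p(q) M_p(r)`. -/
noncomputable def Cp (p q r : ℝ) : ℝ := Mp p (q + r) - Mp p q * Mp p r

/-- `σ²_{p,q}`. -/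
noncomputable def sigmaSq (p q : ℝ) : ℝ :=
  Cp p q q / (q ^ 2 * Mp p q ^ 2) - 2 * Cp p p q / (p * q * Mp p q) + Cp p p p / p ^ 2

/-- `k_{p,n} = n^{1/p} |𝔹_p^n|^{1/n}`. -/
noncomputable def kpn (p : ℝ) (n : ℕ) : ℝ :=
  (n : ℝ) ^ (1 / p) * (volume (pBall n p)).toReal ^ (1 / (n : ℝ))

/-- `A_{p,q,n} = k_{p,n}/(m_{p,q} k_{q,n})`. -/
noncomputable def Apqn (p q : ℝ) (n : ℕ) : ℝ := kpn p n / (mpq p q * kpn q n)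

/-- The distribution function of a centred Gaussian with variance `σ²`. -/
noncomputable def gaussCDF (s2 : ℝ) (x : ℝ) : ℝ :=
  ((ProbabilityTheory.gaussianReal 0 s2.toNNReal) (Iic x)).toReal

/-- The distribution function of a centred Gaussian with variance `σ²`, extended to
`[−∞,∞]` with values `0` at `−∞` and `1` at `+∞`. -/
noncomputable def gaussCDFE (s2 : ℝ) (x : EReal) : ℝ :=
  if x = ⊥ then 0 else if x = ⊤ then 1 else gaussCDF s2 x.toReal

/-- The normalizing constant `∫ exp (-|x|^p / p) dx` of the `p`-generalized Gaussian density. -/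
noncomputable def pGaussConst (p : ℝ) : ℝ := 2 * p ^ (1 / p) * Real.Gamma (1 + 1 / p)

/-- The `p`-generalized Gaussian distribution on the real line. -/
noncomputable def pGauss (p : ℝ) : Measure ℝ :=
  volume.withDensity fun x => ENNReal.ofReal (Real.exp (-(|x| ^ p) / p) / pGaussConst p)

lemma pGaussConst_pos {p : ℝ} (hp : 0 < p) : 0 < pGaussConst p := by
  have := Real.Gamma_pos_of_pos (show 0 < 1 + 1 / p by positivity)
  unfold pGaussConst
  positivity

lemma integral_abs_rpow_mul_exp {p s : ℝ} (hp : 0 < p) (hs : 0 ≤ s) :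
    ∫ x : ℝ, Real.exp (-(|x| ^ p) / p) / pGaussConst p * |x| ^ s = Mp p s := by
  rw [integral_comp_abs (f := fun x => Real.exp (-(x ^ p) / p) / pGaussConst p * x ^ s)]
  have h1 : ∀ x : ℝ, Real.exp (-(x ^ p) / p) / pGaussConst p * x ^ s =
      (pGaussConst p)⁻¹ * (x ^ s * Real.exp (-(1 / p) * x ^ p)) := by
    intro x
    rw [show -(1 / p) * x ^ p = -(x ^ p) / p by ring]
    ring
  simp_rw [h1]
  rw [integral_const_mul, integral_rpow_mul_exp_neg_mul_rpow hp (by linarith) (by positivity)]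
  have hG := Real.Gamma_pos_of_pos (show 0 < 1 + 1 / p by positivity)
  have hG2 : Real.Gamma (1 + (s + 1) / p) = (s + 1) / p * Real.Gamma ((s + 1) / p) := by
    rw [add_comm, Real.Gamma_add_one (by positivity)]
  have hpow : (1 / p) ^ (-(s + 1) / p) = p ^ (s / p) * p ^ (1 / p) := by
    rw [one_div, Real.inv_rpow hp.le, ← Real.rpow_neg hp.le, ← Real.rpow_add hp]
    congr 1
    ring
  have hpp : 0 < p ^ (1 / p) := by positivity
  unfold Mp pGaussConst
  rw [hG2, hpow]
  field_simp

lemma Mp_pos {p s : ℝ} (hp : 0 < p) (hs : 0 ≤ s) : 0 < Mp p s := by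
  have h1 := Real.Gamma_pos_of_pos (show 0 < 1 + 1 / p by positivity)
  have h2 := Real.Gamma_pos_of_pos (show 0 < 1 + (s + 1) / p by positivity)
  unfold Mp
  positivity

lemma Mp_zero {p : ℝ} (hp : 0 < p) : Mp p 0 = 1 := by
  have h1 := Real.Gamma_pos_of_pos (show 0 < 1 + 1 / p by positivity)
  unfold Mp
  rw [zero_div, Real.rpow_zero, zero_add, div_self h1.ne']
  norm_num

lemma Mp_self {p : ℝ} (hp : 0 < p) : Mp p p = 1 := by
  have h1 := Real.Gamma_pos_of_pos (show 0 < 1 + 1 / p by positivity)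
  unfold Mp
  rw [show 1 + (p + 1) / p = (1 + 1 / p) + 1 by field_simp; ring,
    Real.Gamma_add_one (by positivity), div_self hp.ne', Real.rpow_one]
  field_simp

lemma integrable_abs_rpow_mul_exp {p s : ℝ} (hp : 0 < p) (hs : 0 ≤ s) :
    Integrable fun x : ℝ => Real.exp (-(|x| ^ p) / p) / pGaussConst p * |x| ^ s :=
  .of_integral_ne_zero (by rw [integral_abs_rpow_mul_exp hp hs]; exact (Mp_pos hp hs).ne')

lemma integrable_pGauss_iff {p : ℝ} (hp : 0 < p) {g : ℝ → ℝ} :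
    Integrable g (pGauss p) ↔
      Integrable fun x => Real.exp (-(|x| ^ p) / p) / pGaussConst p * g x := by
  have hc := pGaussConst_pos hp
  rw [pGauss, integrable_withDensity_iff_integrable_smul' (by fun_prop) (by simp)]
  refine iff_of_eq (congrArg (fun f => Integrable f volume) (funext fun x => ?_))
  rw [ENNReal.toReal_ofReal (by positivity), smul_eq_mul]

lemma integral_pGauss {p : ℝ} (hp : 0 < p) (g : ℝ → ℝ) :
    ∫ x, g x ∂(pGauss p) = ∫ x, Real.exp (-(|x| ^ p) / p) / pGaussConst p * g x := by
  have hc := pGaussConst_pos hp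
  rw [pGauss, integral_withDensity_eq_integral_toReal_smul (by fun_prop) (by simp)]
  refine integral_congr_ae (.of_forall fun x => ?_)
  simp only
  rw [ENNReal.toReal_ofReal (by positivity), smul_eq_mul]

lemma integrable_abs_rpow_pGauss {p s : ℝ} (hp : 0 < p) (hs : 0 ≤ s) :
    Integrable (fun x => |x| ^ s) (pGauss p) :=
  (integrable_pGauss_iff hp).2 (integrable_abs_rpow_mul_exp hp hs)

lemma integral_abs_rpow_pGauss {p s : ℝ} (hp : 0 < p) (hs : 0 ≤ s) :
    ∫ x, |x| ^ s ∂(pGauss p) = Mp p s := by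
  rw [integral_pGauss hp, integral_abs_rpow_mul_exp hp hs]

lemma isProbabilityMeasure_pGauss {p : ℝ} (hp : 0 < p) : IsProbabilityMeasure (pGauss p) := by
  have hc := pGaussConst_pos hp
  have h1 := integral_abs_rpow_mul_exp hp le_rfl
  have h2 := integrable_abs_rpow_mul_exp hp le_rfl
  simp only [Real.rpow_zero, mul_one, Mp_zero hp] at h1 h2
  constructor
  rw [pGauss, withDensity_apply _ MeasurableSet.univ, setLIntegral_univ,
    ← ofReal_integral_eq_lintegral_ofReal h2 (.of_forall fun x => by positivity), h1,
    ENNReal.ofReal_one]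

lemma pGauss_singleton (p a : ℝ) : pGauss p {a} = 0 :=
  withDensity_absolutelyContinuous _ _ Real.volume_singleton

/-- The law of a vector of `n` independent `p`-generalized Gaussian variables. -/
noncomputable def pGaussPi (p : ℝ) (n : ℕ) : Measure (Fin n → ℝ) :=
  Measure.pi fun _ => pGauss p

lemma pGaussPi_eq_withDensity {p : ℝ} (hp : 0 < p) (n : ℕ) :
    pGaussPi p n = volume.withDensity fun x : Fin n → ℝ =>
      ENNReal.ofReal (Real.exp (-(∑ i, |x i| ^ p) / p) / pGaussConst p ^ n) := by
  have hc := pGaussConst_pos hp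
  have := isProbabilityMeasure_pGauss hp
  have hI : Integrable fun x : ℝ => Real.exp (-(|x| ^ p) / p) / pGaussConst p := by
    simpa using integrable_abs_rpow_mul_exp hp le_rfl
  refine Measure.pi_eq fun s hs => ?_
  have hbox : MeasurableSet (univ.pi s) := MeasurableSet.univ_pi hs
  have hprod : ∀ x : Fin n → ℝ, (univ.pi s).indicator (fun x : Fin n → ℝ =>
        Real.exp (-(∑ i, |x i| ^ p) / p) / pGaussConst p ^ n) x =
      ∏ i, (s i).indicator (fun x => Real.exp (-(|x| ^ p) / p) / pGaussConst p) (x i) := by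
    intro x
    by_cases hx : x ∈ univ.pi s
    · rw [indicator_of_mem hx]
      have : ∀ i, (s i).indicator (fun x => Real.exp (-(|x| ^ p) / p) / pGaussConst p) (x i) =
          Real.exp (-(|x i| ^ p) / p) / pGaussConst p :=
        fun i => indicator_of_mem (hx i (mem_univ i)) _
      simp_rw [this]
      rw [Finset.prod_div_distrib, ← Real.exp_sum, Finset.prod_const, Finset.card_univ,
        Fintype.card_fin, ← Finset.sum_neg_distrib, Finset.sum_div]
    · rw [indicator_of_notMem hx]
      obtain ⟨i, hi⟩ : ∃ i, x i ∉ s i := by simpa [Set.mem_pi] using hx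
      exact (Finset.prod_eq_zero (Finset.mem_univ i) (indicator_of_notMem hi _)).symm
  have hInt : Integrable fun x : Fin n → ℝ => (univ.pi s).indicator (fun x : Fin n → ℝ =>
        Real.exp (-(∑ i, |x i| ^ p) / p) / pGaussConst p ^ n) x := by
    simp_rw [hprod]
    exact Integrable.fintype_prod fun i => hI.indicator (hs i)
  rw [withDensity_apply _ hbox, ← lintegral_indicator hbox]
  have hcomp : ∀ x : Fin n → ℝ, (univ.pi s).indicator (fun x : Fin n → ℝ =>
        ENNReal.ofReal (Real.exp (-(∑ i, |x i| ^ p) / p) / pGaussConst p ^ n)) x =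
      ENNReal.ofReal ((univ.pi s).indicator (fun x : Fin n → ℝ =>
        Real.exp (-(∑ i, |x i| ^ p) / p) / pGaussConst p ^ n) x) := fun x =>
    congrFun (indicator_comp_of_zero (g := ENNReal.ofReal) ENNReal.ofReal_zero) x
  simp_rw [hcomp]
  rw [← ofReal_integral_eq_lintegral_ofReal hInt (.of_forall fun x =>
      indicator_nonneg (fun x _ => by positivity) x)]
  simp_rw [hprod]
  rw [integral_fintype_prod_volume_eq_prod
    (fun i x => (s i).indicator (fun x => Real.exp (-(|x| ^ p) / p) / pGaussConst p) x),
    ENNReal.ofReal_prod_of_nonneg fun i _ => integral_nonneg fun x =>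
      indicator_nonneg (fun x _ => by positivity) x]
  refine Finset.prod_congr rfl fun i _ => ?_
  rw [integral_indicator (hs i), ofReal_integral_eq_lintegral_ofReal hI.integrableOn
    (.of_forall fun x => by positivity), pGauss, withDensity_apply _ (hs i)]

lemma pBall_eq {p : ℝ} (hp : 0 < p) (n : ℕ) : pBall n p = {x | ∑ i, |x i| ^ p ≤ 1} := by
  ext x
  have h : 0 ≤ ∑ i, |x i| ^ p := by positivity
  simp only [pBall, pnorm, mem_ofPred_eq]
  have := Real.rpow_le_rpow_iff h zero_le_one (one_div_pos.2 hp)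
  rwa [Real.one_rpow] at this

lemma pnorm_smul {p : ℝ} (hp : 0 < p) {n : ℕ} {r : ℝ} (hr : 0 ≤ r) (x : Fin n → ℝ) :
    pnorm p (r • x) = r * pnorm p x := by
  have h : 0 ≤ ∑ i, |x i| ^ p := by positivity
  simp only [pnorm, Pi.smul_apply, smul_eq_mul, abs_mul, abs_of_nonneg hr,
    Real.mul_rpow hr (abs_nonneg _), ← Finset.mul_sum]
  rw [Real.mul_rpow (by positivity) h, ← Real.rpow_mul hr, mul_one_div_cancel hp.ne',
    Real.rpow_one]

lemma measurable_pnorm (p : ℝ) (n : ℕ) : Measurable fun x : Fin n → ℝ => pnorm p x := by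
  unfold pnorm; fun_prop

lemma lintegral_exp_neg_Ici {p : ℝ} (hp : 0 < p) (s : ℝ) :
    ∫⁻ u in Ici s, ENNReal.ofReal (Real.exp (-u / p) / p) =
      ENNReal.ofReal (Real.exp (-s / p)) := by
  have hneg : -(1 / p) < 0 := by simpa using hp
  have h : ∀ u : ℝ, Real.exp (-u / p) / p = Real.exp (-(1 / p) * u) * (1 / p) := by
    intro u
    rw [show -(1 / p) * u = -u / p by ring]
    ring
  simp_rw [h]
  rw [setLIntegral_congr Ioi_ae_eq_Ici.symm, ← ofReal_integral_eq_lintegral_ofReal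
    ((integrableOn_exp_mul_Ioi hneg s).mul_const _) (.of_forall fun u => by positivity),
    integral_mul_const, integral_exp_mul_Ioi hneg]
  congr 1
  rw [show -(1 / p) * s = -s / p by ring]
  field_simp

lemma lintegral_rpow_mul_exp {p a : ℝ} (hp : 0 < p) (ha : 0 ≤ a) :
    ∫⁻ u in Ioi 0, ENNReal.ofReal (Real.exp (-u / p) / p) * ENNReal.ofReal (u ^ a) =
      ENNReal.ofReal (p ^ a * Real.Gamma (a + 1)) := by
  have hG := Real.Gamma_pos_of_pos (show 0 < a + 1 by positivity)
  have h : ∀ u : ℝ, Real.exp (-u / p) / p * u ^ a =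
      1 / p * (u ^ (a + 1 - 1) * Real.exp (-(1 / p * u))) := by
    intro u
    rw [show -(1 / p * u) = -u / p by ring, add_sub_cancel_right]
    ring
  have hval : ∫ u in Ioi 0, Real.exp (-u / p) / p * u ^ a = p ^ a * Real.Gamma (a + 1) := by
    simp_rw [h]
    rw [integral_const_mul, Real.integral_rpow_mul_exp_neg_mul_Ioi (by positivity) (by positivity),
      one_div_one_div, Real.rpow_add_one hp.ne']
    field_simp
  rw [← hval, ofReal_integral_eq_lintegral_ofReal
    (.of_integral_ne_zero (by rw [hval]; positivity))]
  · refine setLIntegral_congr_fun measurableSet_Ioi fun u _ => ?_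
    rw [ENNReal.ofReal_mul (by positivity)]
  · filter_upwards [ae_restrict_mem measurableSet_Ioi] with u hu
    have : (0 : ℝ) < u := hu
    simp only [Pi.zero_apply]
    positivity

/-- The Lebesgue measure of a section of a cone scales with the level. -/
lemma volume_cone_sublevel {p : ℝ} (hp : 0 < p) {n : ℕ} {C : Set (Fin n → ℝ)}
    (hC : ∀ r : ℝ, 0 < r → ∀ x ∈ C, r • x ∈ C) {u : ℝ} (hu : 0 < u) :
    volume (C ∩ {x | ∑ i, |x i| ^ p ≤ u}) =
      ENNReal.ofReal (u ^ ((n : ℝ) / p)) * volume (C ∩ pBall n p) := by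
  have hr : 0 < u ^ (1 / p) := by positivity
  have hru : (u ^ (1 / p)) ^ p = u := by
    rw [← Real.rpow_mul hu.le, one_div_mul_cancel hp.ne', Real.rpow_one]
  have hset : C ∩ {x | ∑ i, |x i| ^ p ≤ u} = u ^ (1 / p) • (C ∩ pBall n p) := by
    ext x
    rw [mem_smul_set_iff_inv_smul_mem₀ hr.ne', pBall_eq hp]
    simp only [mem_inter_iff, mem_ofPred_eq, Pi.smul_apply, smul_eq_mul, abs_mul,
      Real.mul_rpow (abs_nonneg _) (abs_nonneg _), ← Finset.mul_sum]
    rw [abs_of_pos (by positivity), Real.inv_rpow hr.le, hru, inv_mul_le_one₀ hu]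
    refine and_congr_left fun _ => ⟨fun h => hC _ (by positivity) _ h, fun h => ?_⟩
    have := hC _ hr _ h
    rwa [smul_inv_smul₀ hr.ne'] at this
  rw [hset, Measure.addHaar_smul, Module.finrank_fin_fun, abs_of_pos (by positivity),
    ← Real.rpow_natCast, ← Real.rpow_mul hu.le]
  congr 3
  ring

lemma lintegral_exp_cone {p : ℝ} (hp : 0 < p) {n : ℕ} {C : Set (Fin n → ℝ)}
    (hC : ∀ r : ℝ, 0 < r → ∀ x ∈ C, r • x ∈ C) :
    ∫⁻ x in C, ENNReal.ofReal (Real.exp (-(∑ i, |x i| ^ p) / p)) =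
      ENNReal.ofReal (p ^ ((n : ℝ) / p) * Real.Gamma ((n : ℝ) / p + 1)) *
        volume (C ∩ pBall n p) := by
  have hS : Measurable fun x : Fin n → ℝ => ∑ i, |x i| ^ p := by fun_prop
  calc
    _ = ∫⁻ x in C, ∫⁻ u in Ioi 0, {z : (Fin n → ℝ) × ℝ | ∑ i, |z.1 i| ^ p ≤ z.2}.indicator
          (fun z => ENNReal.ofReal (Real.exp (-z.2 / p) / p)) (x, u) := by
        refine lintegral_congr fun x => ?_
        have h0 : 0 ≤ ∑ i, |x i| ^ p := by positivity
        rw [← lintegral_exp_neg_Ici hp, ← setLIntegral_congr Ioi_ae_eq_Ici,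
          ← setLIntegral_congr (Ioi_ae_eq_Ici (a := (0 : ℝ))).symm,
          setLIntegral_congr Ioi_ae_eq_Ici, ← lintegral_indicator measurableSet_Ici,
          ← lintegral_indicator measurableSet_Ici]
        refine lintegral_congr fun u => ?_
        by_cases hu : ∑ i, |x i| ^ p ≤ u
        · rw [indicator_of_mem (by exact hu), indicator_of_mem (by exact h0.trans hu),
            indicator_of_mem (by exact hu)]
        · rw [indicator_of_notMem (by exact hu)]
          by_cases hu0 : u ∈ Ici (0 : ℝ)
          · rw [indicator_of_mem hu0, indicator_of_notMem (by exact hu)]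
          · rw [indicator_of_notMem hu0]
    _ = ∫⁻ u in Ioi 0, ∫⁻ x in C, {z : (Fin n → ℝ) × ℝ | ∑ i, |z.1 i| ^ p ≤ z.2}.indicator
          (fun z => ENNReal.ofReal (Real.exp (-z.2 / p) / p)) (x, u) := by
        refine lintegral_lintegral_swap (Measurable.aemeasurable ?_)
        refine Measurable.indicator (by fun_prop) (measurableSet_le ?_ measurable_snd)
        fun_prop
    _ = ∫⁻ u in Ioi 0, ENNReal.ofReal (Real.exp (-u / p) / p) *
          ENNReal.ofReal (u ^ ((n : ℝ) / p)) * volume (C ∩ pBall n p) := by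
        refine setLIntegral_congr_fun measurableSet_Ioi fun u hu => ?_
        have hm : MeasurableSet {x : Fin n → ℝ | ∑ i, |x i| ^ p ≤ u} :=
          measurableSet_le hS measurable_const
        have : ∀ x : Fin n → ℝ, {z : (Fin n → ℝ) × ℝ | ∑ i, |z.1 i| ^ p ≤ z.2}.indicator
            (fun z => ENNReal.ofReal (Real.exp (-z.2 / p) / p)) (x, u) =
            {x : Fin n → ℝ | ∑ i, |x i| ^ p ≤ u}.indicator
              (fun _ => ENNReal.ofReal (Real.exp (-u / p) / p)) x := fun x => rfl
        simp_rw [this]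
        rw [lintegral_indicator_const hm, Measure.restrict_apply hm, inter_comm,
          volume_cone_sublevel hp hC hu, mul_assoc]
    _ = _ := by
        rw [lintegral_mul_const _ (by fun_prop), lintegral_rpow_mul_exp hp (by positivity)]

lemma pGaussPi_cone {p : ℝ} (hp : 0 < p) {n : ℕ} {C : Set (Fin n → ℝ)}
    (hCm : MeasurableSet C) (hC : ∀ r : ℝ, 0 < r → ∀ x ∈ C, r • x ∈ C) :
    pGaussPi p n C = ENNReal.ofReal ((p ^ ((n : ℝ) / p) * Real.Gamma ((n : ℝ) / p + 1)) /
        pGaussConst p ^ n) * volume (C ∩ pBall n p) := by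
  have hc := pGaussConst_pos hp
  have hG := Real.Gamma_pos_of_pos (show 0 < (n : ℝ) / p + 1 by positivity)
  rw [pGaussPi_eq_withDensity hp, withDensity_apply _ hCm]
  simp_rw [div_eq_mul_inv _ (pGaussConst p ^ n)]
  rw [ENNReal.ofReal_mul (by positivity), mul_right_comm, ← lintegral_exp_cone hp hC,
    ← lintegral_mul_const _ (by fun_prop)]
  refine lintegral_congr fun x => ?_
  rw [← ENNReal.ofReal_mul (by positivity)]

lemma volume_pBall {p : ℝ} (hp : 0 < p) (n : ℕ) :
    volume (pBall n p) = ENNReal.ofReal (pGaussConst p ^ n /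
      (p ^ ((n : ℝ) / p) * Real.Gamma ((n : ℝ) / p + 1))) := by
  have hc := pGaussConst_pos hp
  have hG := Real.Gamma_pos_of_pos (show 0 < (n : ℝ) / p + 1 by positivity)
  have := isProbabilityMeasure_pGauss hp
  have h := pGaussPi_cone hp (n := n) MeasurableSet.univ fun _ _ _ _ => mem_univ _
  rw [pGaussPi, measure_univ, univ_inter] at h
  have hpos : 0 < p ^ ((n : ℝ) / p) * Real.Gamma ((n : ℝ) / p + 1) / pGaussConst p ^ n := by
    positivity
  rw [← inv_div, ENNReal.ofReal_inv_of_pos hpos]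
  exact ENNReal.eq_inv_of_mul_eq_one_left (by rw [mul_comm]; exact h.symm)

lemma volume_pBall_toReal_pos {p : ℝ} (hp : 0 < p) (n : ℕ) :
    0 < (volume (pBall n p)).toReal := by
  have hc := pGaussConst_pos hp
  have hG := Real.Gamma_pos_of_pos (show 0 < (n : ℝ) / p + 1 by positivity)
  rw [volume_pBall hp, ENNReal.toReal_ofReal (by positivity)]
  positivity

lemma pGaussPi_cone_toReal {p : ℝ} (hp : 0 < p) {n : ℕ} {C : Set (Fin n → ℝ)}
    (hCm : MeasurableSet C) (hC : ∀ r : ℝ, 0 < r → ∀ x ∈ C, r • x ∈ C) :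
    (pGaussPi p n C).toReal =
      (volume (C ∩ pBall n p)).toReal / (volume (pBall n p)).toReal := by
  have hc := pGaussConst_pos hp
  have hG := Real.Gamma_pos_of_pos (show 0 < (n : ℝ) / p + 1 by positivity)
  rw [pGaussPi_cone hp hCm hC, volume_pBall hp, ENNReal.toReal_mul,
    ENNReal.toReal_ofReal (by positivity), ENNReal.toReal_ofReal (by positivity)]
  field_simp

lemma smul_pBall {p : ℝ} (hp : 0 < p) (n : ℕ) {r : ℝ} (hr : 0 < r) :
    r • pBall n p = {x | pnorm p x ≤ r} := by
  ext x
  rw [mem_smul_set_iff_inv_smul_mem₀ hr.ne']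
  simp only [pBall, mem_ofPred_eq, pnorm_smul hp (inv_nonneg.2 hr.le)]
  rw [inv_mul_le_one₀ hr]

lemma volume_pBall_ne_top {p : ℝ} (hp : 0 < p) (n : ℕ) : volume (pBall n p) ≠ ∞ := by
  rw [volume_pBall hp]
  exact ENNReal.ofReal_ne_top

/-- The probability that a `p`-generalized Gaussian vector satisfies `‖x‖_q ≤ s ‖x‖_p`. -/
noncomputable def coneProb (p q : ℝ) (n : ℕ) (s : ℝ) : ℝ :=
  (pGaussPi p n {x | pnorm q x ≤ s * pnorm p x}).toReal

lemma coneProb_eq {p q : ℝ} (hp : 0 < p) (hq : 0 < q) (n : ℕ) (s : ℝ) :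
    coneProb p q n s = (volume ({x | pnorm q x ≤ s * pnorm p x} ∩ pBall n p)).toReal /
      (volume (pBall n p)).toReal := by
  refine pGaussPi_cone_toReal hp (measurableSet_le (measurable_pnorm q n)
    ((measurable_pnorm p n).const_mul s)) fun r hr x hx => ?_
  simp only [mem_ofPred_eq, pnorm_smul hp hr.le, pnorm_smul hq hr.le] at hx ⊢
  nlinarith

/-- The dilation factor between non-normalized balls corresponding to `t`. -/
noncomputable def dilation (p q : ℝ) (n : ℕ) (t : ℝ) : ℝ :=
  t * ((volume (pBall n p)).toReal ^ (1 / (n : ℝ)) / (volume (pBall n q)).toReal ^ (1 / (n : ℝ)))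

lemma dilation_pos {p q : ℝ} (hp : 0 < p) (hq : 0 < q) (n : ℕ) {t : ℝ} (ht : 0 < t) :
    0 < dilation p q n t := by
  have h1 := volume_pBall_toReal_pos hp n
  have h2 := volume_pBall_toReal_pos hq n
  unfold dilation
  positivity

lemma volume_nBall_inter {p q : ℝ} (hp : 0 < p) (hq : 0 < q) {n : ℕ} (hn : n ≠ 0) {t : ℝ}
    (ht : 0 < t) : (volume (nBall n p ∩ t • nBall n q)).toReal =
      (volume (pBall n p ∩ {x | pnorm q x ≤ dilation p q n t})).toReal /
        (volume (pBall n p)).toReal := by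
  have h1 := volume_pBall_toReal_pos hp n
  have h2 := volume_pBall_toReal_pos hq n
  set a := (volume (pBall n p)).toReal with ha
  set b := (volume (pBall n q)).toReal with hb
  have ha' : 0 < a ^ (-(1 / (n : ℝ))) := by positivity
  have hset : nBall n p ∩ t • nBall n q =
      a ^ (-(1 / (n : ℝ))) • (pBall n p ∩ {x | pnorm q x ≤ dilation p q n t}) := by
    rw [← smul_pBall hq n (dilation_pos hp hq n ht), smul_set_inter₀ ha'.ne', nBall, nBall,
      smul_smul, smul_smul, ← ha, ← hb]
    congr 2
    rw [dilation, ← ha, ← hb, Real.rpow_neg h1.le, Real.rpow_neg h2.le]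
    have : 0 < a ^ (1 / (n : ℝ)) := by positivity
    field_simp
  rw [hset, Measure.addHaar_smul, Module.finrank_fin_fun, abs_of_pos (by positivity),
    ENNReal.toReal_mul, ENNReal.toReal_ofReal (by positivity), ← Real.rpow_natCast,
    ← Real.rpow_mul h1.le, neg_mul, one_div_mul_cancel (by exact_mod_cast hn), Real.rpow_neg_one]
  ring

lemma coneProb_le_volume {p q : ℝ} (hp : 0 < p) (hq : 0 < q) {n : ℕ} (hn : n ≠ 0) {t : ℝ}
    (ht : 0 < t) :
    coneProb p q n (dilation p q n t) ≤ (volume (nBall n p ∩ t • nBall n q)).toReal := by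
  rw [coneProb_eq hp hq, volume_nBall_inter hp hq hn ht]
  have hs := dilation_pos hp hq n ht
  refine div_le_div_of_nonneg_right (ENNReal.toReal_mono
    (measure_ne_top_of_subset inter_subset_left (volume_pBall_ne_top hp n))
    (measure_mono ?_)) ENNReal.toReal_nonneg
  rintro x ⟨hx, hxp⟩
  have hxp' : pnorm p x ≤ 1 := hxp
  have hx' : pnorm q x ≤ _ := hx
  exact ⟨hxp, hx'.trans (mul_le_of_le_one_right hs.le hxp')⟩

lemma volume_le_coneProb {p q : ℝ} (hp : 0 < p) (hq : 0 < q) {n : ℕ} (hn : n ≠ 0) {t κ : ℝ}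
    (ht : 0 < t) (hκ : 0 < κ) :
    (volume (nBall n p ∩ t • nBall n q)).toReal ≤
      κ⁻¹ ^ n + coneProb p q n (κ * dilation p q n t) := by
  rw [coneProb_eq hp hq, volume_nBall_inter hp hq hn ht]
  have hs := dilation_pos hp hq n ht
  have hb := volume_pBall_toReal_pos hp n
  have hsmall : (volume {x : Fin n → ℝ | pnorm p x ≤ κ⁻¹}).toReal =
      κ⁻¹ ^ n * (volume (pBall n p)).toReal := by
    rw [← smul_pBall hp n (inv_pos.2 hκ), Measure.addHaar_smul, Module.finrank_fin_fun,
      abs_of_pos (by positivity), ENNReal.toReal_mul, ENNReal.toReal_ofReal (by positivity)]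
  have hfin : volume {x : Fin n → ℝ | pnorm p x ≤ κ⁻¹} ≠ ∞ := by
    intro h
    rw [h, ENNReal.toReal_top] at hsmall
    have : 0 < κ⁻¹ ^ n * (volume (pBall n p)).toReal := by positivity
    linarith
  have hfin' : volume ({x : Fin n → ℝ | pnorm q x ≤ κ * dilation p q n t * pnorm p x} ∩
      pBall n p) ≠ ∞ :=
    measure_ne_top_of_subset inter_subset_right (volume_pBall_ne_top hp n)
  rw [div_le_iff₀ hb, add_mul, div_mul_cancel₀ _ hb.ne', ← hsmall,
    ← ENNReal.toReal_add hfin hfin']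
  refine ENNReal.toReal_mono (ENNReal.add_ne_top.2 ⟨hfin, hfin'⟩)
    ((measure_mono fun x hx => ?_).trans (measure_union_le _ _))
  obtain ⟨hxp, hxq⟩ := hx
  by_cases h : pnorm p x ≤ κ⁻¹
  · exact Or.inl h
  · refine Or.inr ⟨?_, hxp⟩
    have hxq' : pnorm q x ≤ _ := hxq
    refine hxq'.trans ?_
    have h1 : 1 ≤ κ * pnorm p x := by
      rw [not_le, inv_lt_iff_one_lt_mul₀ hκ, mul_comm] at h
      exact h.le
    nlinarith

lemma le_log_Gamma_add_one {x : ℝ} (hx : 0 < x) :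
    x * Real.log x - x ≤ Real.log (Real.Gamma (x + 1)) := by
  have hI := Real.GammaIntegral_convergent (show 0 < x + 1 by positivity)
  have hE : IntegrableOn (fun t : ℝ => x ^ x * Real.exp (-t)) (Ioi x) :=
    (integrableOn_exp_neg_Ioi x).const_mul _
  have h : x ^ x * Real.exp (-x) ≤ Real.Gamma (x + 1) := by
    rw [Real.Gamma_eq_integral (by positivity), ← integral_exp_neg_Ioi, ← integral_const_mul]
    calc _ ≤ ∫ t in Ioi x, Real.exp (-t) * t ^ (x + 1 - 1) := by
          refine setIntegral_mono_on hE (hI.mono_set (Ioi_subset_Ioi hx.le)) measurableSet_Ioi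
            fun t ht => ?_
          rw [add_sub_cancel_right, mul_comm]
          have : x < t := ht
          gcongr
      _ ≤ _ := by
          refine setIntegral_mono_set hI ?_ (Ioi_subset_Ioi hx.le).eventuallyLE
          filter_upwards [ae_restrict_mem measurableSet_Ioi] with t ht
          have : (0 : ℝ) < t := ht
          simp only [Pi.zero_apply]
          positivity
  have h2 := Real.log_le_log (by positivity) h
  rwa [Real.log_mul (by positivity) (by positivity), Real.log_rpow hx, Real.log_exp] at h2

lemma log_Gamma_add_one_le {x : ℝ} (hx : 0 < x) :
    Real.log (Real.Gamma (x + 1)) ≤ x * Real.log x - x + (1 + Real.log (x + 1)) := by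
  have hI := Real.GammaIntegral_convergent (show 0 < x + 1 by positivity)
  have hneg : -(1 / (x + 1)) < 0 := by
    rw [neg_lt_zero]
    positivity
  have h : Real.Gamma (x + 1) ≤ (x + 1) ^ x * Real.exp (-x) * (x + 1) := by
    have hval : ∫ t in Ioi (0 : ℝ), Real.exp (-(1 / (x + 1)) * t) = x + 1 := by
      rw [integral_exp_mul_Ioi hneg]
      simp
    rw [Real.Gamma_eq_integral (by positivity),
      show (x + 1) ^ x * Real.exp (-x) * (x + 1) = ∫ t in Ioi (0 : ℝ),
        (x + 1) ^ x * Real.exp (-x) * Real.exp (-(1 / (x + 1)) * t) by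
          rw [integral_const_mul, hval]]
    refine setIntegral_mono_on hI ((integrableOn_exp_mul_Ioi hneg 0).const_mul _)
      measurableSet_Ioi fun t ht => ?_
    have ht : 0 < t := ht
    rw [add_sub_cancel_right, Real.rpow_def_of_pos ht, Real.rpow_def_of_pos (by positivity),
      ← Real.exp_add, ← Real.exp_add, ← Real.exp_add, Real.exp_le_exp]
    have h1 := Real.log_le_sub_one_of_pos (show 0 < t / (x + 1) by positivity)
    rw [Real.log_div ht.ne' (by positivity)] at h1
    have h2 : t = t / (x + 1) * x + t / (x + 1) := by field_simp
    have h3 : -(1 / (x + 1)) * t = -(t / (x + 1)) := by ring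
    rw [h3]
    nlinarith
  have h2 := Real.log_le_log (Real.Gamma_pos_of_pos (by positivity)) h
  rw [Real.log_mul (by positivity) (by positivity), Real.log_mul (by positivity) (by positivity),
    Real.log_rpow (by positivity), Real.log_exp] at h2
  have h3 := Real.log_le_sub_one_of_pos (show 0 < (x + 1) / x by positivity)
  rw [Real.log_div (by positivity) hx.ne'] at h3
  have h4 : x * ((x + 1) / x) = x + 1 := by field_simp
  nlinarith

lemma tendsto_sqrt_mul_log_kpn {p : ℝ} (hp : 0 < p) :
    Tendsto (fun n : ℕ => Real.sqrt n *
      (Real.log (kpn p n) - (Real.log (pGaussConst p) + 1 / p))) atTop (𝓝 0) := by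
  have hc := pGaussConst_pos hp
  have hlim : Tendsto (fun n : ℕ => (1 + Real.log ((n : ℝ) / p + 1)) / Real.sqrt n)
      atTop (𝓝 0) := by
    have hx : Tendsto (fun n : ℕ => (n : ℝ) / p + 1) atTop atTop :=
      tendsto_atTop_add_const_right _ _ (tendsto_natCast_atTop_atTop.atTop_div_const hp)
    have h1 : Tendsto (fun n : ℕ => 1 / Real.sqrt n) atTop (𝓝 0) :=
      tendsto_const_nhds.div_atTop (Real.tendsto_sqrt_atTop.comp tendsto_natCast_atTop_atTop)
    have h2 : (fun n : ℕ => Real.log ((n : ℝ) / p + 1)) =o[atTop] fun n : ℕ => Real.sqrt n := by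
      have h3 := (isLittleO_log_rpow_atTop (show (0 : ℝ) < 1 / 2 by norm_num)).comp_tendsto hx
      refine h3.trans_isBigO (.of_bound (Real.sqrt (1 / p + 1)) ?_)
      filter_upwards [eventually_ge_atTop 1] with n hn
      have hn' : (1 : ℝ) ≤ n := by exact_mod_cast hn
      simp only [Function.comp]
      rw [← Real.sqrt_eq_rpow, Real.norm_of_nonneg (Real.sqrt_nonneg _),
        Real.norm_of_nonneg (Real.sqrt_nonneg _), ← Real.sqrt_mul (by positivity)]
      refine Real.sqrt_le_sqrt ?_
      rw [add_mul, one_mul, one_div_mul_eq_div]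
      linarith
    have h4 := h1.add h2.tendsto_div_nhds_zero
    rw [add_zero] at h4
    refine h4.congr fun n => ?_
    rw [add_div]
  refine squeeze_zero_norm' ?_ hlim
  filter_upwards [eventually_ge_atTop 1] with n hn
  have hn' : (0 : ℝ) < n := by exact_mod_cast hn
  have hs : 0 < Real.sqrt n := Real.sqrt_pos.2 hn'
  have hss : Real.sqrt n * Real.sqrt n = n := Real.mul_self_sqrt hn'.le
  have hx : 0 < (n : ℝ) / p := by positivity
  have hG := Real.Gamma_pos_of_pos (show 0 < (n : ℝ) / p + 1 by positivity)
  have hk : Real.log (kpn p n) - (Real.log (pGaussConst p) + 1 / p) =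
      -((Real.log (Real.Gamma ((n : ℝ) / p + 1)) -
        ((n : ℝ) / p * Real.log ((n : ℝ) / p) - (n : ℝ) / p)) / n) := by
    rw [kpn, volume_pBall hp, ENNReal.toReal_ofReal (by positivity),
      Real.log_mul (by positivity) (by positivity), Real.log_rpow hn', Real.log_rpow (by positivity),
      Real.log_div (by positivity) (by positivity), Real.log_mul (by positivity) hG.ne',
      Real.log_pow, Real.log_rpow hp, Real.log_div hn'.ne' hp.ne']
    field_simp
    ring
  have h1 := le_log_Gamma_add_one hx
  have h2 := log_Gamma_add_one_le hx
  have hdiv : ∀ y : ℝ, Real.sqrt n * (y / n) = y / Real.sqrt n := by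
    intro y
    rw [← mul_div_assoc, div_eq_div_iff hn'.ne' hs.ne', mul_right_comm, hss, mul_comm]
  rw [hk, mul_neg, norm_neg, Real.norm_of_nonneg
    (mul_nonneg hs.le (div_nonneg (by linarith) hn'.le)), hdiv]
  gcongr
  linarith

lemma kpn_pos {p : ℝ} (hp : 0 < p) {n : ℕ} (hn : n ≠ 0) : 0 < kpn p n := by
  have h1 := volume_pBall_toReal_pos hp n
  have : (0 : ℝ) < n := by exact_mod_cast Nat.pos_of_ne_zero hn
  unfold kpn
  positivity

lemma mpq_pos {p q : ℝ} (hp : 0 < p) (hq : 0 < q) : 0 < mpq p q :=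
  Real.rpow_pos_of_pos (Mp_pos hp hq.le) _

lemma Apqn_pos {p q : ℝ} (hp : 0 < p) (hq : 0 < q) {n : ℕ} (hn : n ≠ 0) : 0 < Apqn p q n := by
  have h1 := kpn_pos hp hn
  have h2 := kpn_pos hq hn
  have h3 := mpq_pos hp hq
  unfold Apqn
  positivity

/-- `A_{p,q,n}` converges to `A_{p,q}` faster than `1/√n`. -/
lemma tendsto_sqrt_mul_log_Apqn {p q A : ℝ} (hp : 0 < p) (hq : 0 < q)
    (hA : Tendsto (fun n : ℕ => Apqn p q n) atTop (𝓝 A)) (hApos : 0 < A) :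
    Tendsto (fun n : ℕ => Real.sqrt n * (Real.log (Apqn p q n) - Real.log A)) atTop (𝓝 0) := by
  obtain ⟨B, hB⟩ : ∃ B : ℝ, Tendsto
      (fun n : ℕ => Real.sqrt n * (Real.log (Apqn p q n) - B)) atTop (𝓝 0) := by
    refine ⟨Real.log (pGaussConst p) + 1 / p - Real.log (mpq p q) -
      (Real.log (pGaussConst q) + 1 / q), ?_⟩
    have h := (tendsto_sqrt_mul_log_kpn hp).sub (tendsto_sqrt_mul_log_kpn hq)
    rw [sub_zero] at h
    refine h.congr' ?_
    filter_upwards [eventually_ne_atTop 0] with n hn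
    have h1 := kpn_pos hp hn
    have h2 := kpn_pos hq hn
    have h3 := mpq_pos hp hq
    rw [Apqn, Real.log_div h1.ne' (by positivity), Real.log_mul h3.ne' h2.ne']
    ring
  have hs : Tendsto (fun n : ℕ => Real.sqrt n) atTop atTop :=
    Real.tendsto_sqrt_atTop.comp tendsto_natCast_atTop_atTop
  have hlogA := hA.log hApos.ne'
  have h0 : Tendsto (fun n : ℕ => Real.log (Apqn p q n) - B) atTop (𝓝 0) := by
    have := hs.inv_tendsto_atTop.mul hB
    rw [zero_mul] at this
    refine this.congr' ?_
    filter_upwards [hs.eventually_gt_atTop 0] with n hn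
    simp only [Pi.inv_apply]
    rw [inv_mul_cancel_left₀ hn.ne']
  have hBA : B = Real.log A := by
    have := tendsto_nhds_unique h0 (hlogA.sub_const B)
    linarith
  rwa [hBA] at hB

section IID

open ProbabilityTheory

variable {μ : Measure ℝ} [IsProbabilityMeasure μ]

lemma identDistrib_infinitePi_eval {f : ℝ → ℝ} (hf : Measurable f) (k : ℕ) :
    IdentDistrib (fun ω : ℕ → ℝ => f (ω k)) f (Measure.infinitePi fun _ => μ) μ where
  aemeasurable_fst := (hf.comp (measurable_pi_apply k)).aemeasurable
  aemeasurable_snd := hf.aemeasurable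
  map_eq := by
    have h : (Measure.infinitePi fun _ : ℕ => μ).map (fun ω => ω k) = μ :=
      Measure.infinitePi_map_eval (fun _ : ℕ => μ) k
    rw [← congrArg (Measure.map f) h, Measure.map_map hf (measurable_pi_apply k)]
    rfl

lemma iIndepFun_infinitePi_eval {f : ℝ → ℝ} (hf : Measurable f) :
    iIndepFun (fun (k : ℕ) (ω : ℕ → ℝ) => f (ω k)) (Measure.infinitePi fun _ => μ) :=
  iIndepFun_infinitePi (X := fun _ => f) fun _ => hf

lemma memLp_infinitePi_eval {f : ℝ → ℝ} (hf : Measurable f) (hf2 : MemLp f 2 μ) (k : ℕ) :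
    MemLp (fun ω : ℕ → ℝ => f (ω k)) 2 (Measure.infinitePi fun _ => μ) :=
  (identDistrib_infinitePi_eval hf k).memLp_iff.2 hf2

lemma variance_sum_infinitePi {f : ℝ → ℝ} (hf : Measurable f) (hf2 : MemLp f 2 μ) (n : ℕ) :
    Var[∑ k ∈ Finset.range n, fun ω : ℕ → ℝ => f (ω k); Measure.infinitePi fun _ => μ] =
      n * Var[f; μ] := by
  rw [IndepFun.variance_sum (fun k _ => memLp_infinitePi_eval hf hf2 k)
    fun i _ j _ hij => (iIndepFun_infinitePi_eval hf).indepFun hij,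
    Finset.sum_congr rfl fun k _ => (identDistrib_infinitePi_eval hf k).variance_eq]
  simp

lemma measure_abs_average_sub_one_le {f : ℝ → ℝ} (hf : Measurable f) (hf2 : MemLp f 2 μ)
    (hf1 : ∫ x, f x ∂μ = 1) {n : ℕ} (hn : n ≠ 0) {c : ℝ} (hc : 0 < c) :
    Measure.infinitePi (fun _ : ℕ => μ)
      {ω | c ≤ |(∑ k ∈ Finset.range n, f (ω k)) / n - 1|} ≤
        ENNReal.ofReal (Var[f; μ] / (n * c ^ 2)) := by
  have hn' : (0 : ℝ) < n := by exact_mod_cast Nat.pos_of_ne_zero hn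
  have hmem : MemLp (∑ k ∈ Finset.range n, fun ω : ℕ → ℝ => f (ω k)) 2
      (Measure.infinitePi fun _ => μ) :=
    memLp_finsetSum' _ fun k _ => memLp_infinitePi_eval hf hf2 k
  have hmean : ∫ ω, (∑ k ∈ Finset.range n, fun ω : ℕ → ℝ => f (ω k)) ω
      ∂(Measure.infinitePi fun _ => μ) = n := by
    simp_rw [Finset.sum_apply]
    rw [integral_finsetSum _ fun k _ =>
      (memLp_infinitePi_eval hf hf2 k).integrable (by norm_num),
      Finset.sum_congr rfl fun k _ => (identDistrib_infinitePi_eval hf k).integral_eq, hf1]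
    simp
  have h := meas_ge_le_variance_div_sq hmem (show 0 < n * c by positivity)
  rw [variance_sum_infinitePi hf hf2, hmean] at h
  rw [show Var[f; μ] / (n * c ^ 2) = n * Var[f; μ] / (n * c) ^ 2 by field_simp]
  refine (measure_mono fun ω hω => ?_).trans h
  simp only [mem_ofPred_eq, Finset.sum_apply] at hω ⊢
  have : ∑ k ∈ Finset.range n, f (ω k) - n = n * ((∑ k ∈ Finset.range n, f (ω k)) / n - 1) := by
    field_simp
  rw [this, abs_mul, abs_of_pos hn']
  gcongr

lemma abs_log_sub_le {x : ℝ} (hx : |x - 1| ≤ 1 / 2) :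
    |Real.log x - (x - 1)| ≤ 2 * (x - 1) ^ 2 := by
  have hx1 := (abs_le.1 hx).1
  have hx0 : 0 < x := by linarith
  have h1 := Real.log_le_sub_one_of_pos hx0
  have h2 := Real.one_sub_inv_le_log_of_pos hx0
  have h3 : 1 - x⁻¹ - (x - 1) = -((x - 1) ^ 2 / x) := by
    field_simp
    ring
  have h4 : (x - 1) ^ 2 / x ≤ 2 * (x - 1) ^ 2 := by
    rw [div_le_iff₀ hx0]
    nlinarith [sq_nonneg (x - 1)]
  rw [abs_le]
  constructor <;> linarith [sq_nonneg (x - 1)]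

lemma tendstoInMeasure_log_average {f : ℝ → ℝ} (hf : Measurable f) (hf2 : MemLp f 2 μ)
    (hf1 : ∫ x, f x ∂μ = 1) :
    TendstoInMeasure (Measure.infinitePi fun _ : ℕ => μ)
      (fun (n : ℕ) ω => Real.sqrt n * (Real.log ((∑ k ∈ Finset.range n, f (ω k)) / n) -
        ((∑ k ∈ Finset.range n, f (ω k)) / n - 1))) atTop 0 := by
  rw [tendstoInMeasure_iff_norm]
  intro ε hε
  have hs : Tendsto (fun n : ℕ => Real.sqrt n) atTop atTop :=
    Real.tendsto_sqrt_atTop.comp tendsto_natCast_atTop_atTop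
  have hlim : Tendsto (fun n : ℕ => ENNReal.ofReal (2 * Var[f; μ] / ε / Real.sqrt n))
      atTop (𝓝 0) := by
    rw [← ENNReal.ofReal_zero]
    exact ENNReal.tendsto_ofReal (tendsto_const_nhds.div_atTop hs)
  refine tendsto_of_tendsto_of_tendsto_of_le_of_le' tendsto_const_nhds hlim
    (.of_forall fun _ => zero_le) ?_
  filter_upwards [hs.eventually_ge_atTop (2 * ε), eventually_ne_atTop 0] with n hn hn0
  have hn' : (0 : ℝ) < n := by exact_mod_cast Nat.pos_of_ne_zero hn0
  have hsn : 0 < Real.sqrt n := Real.sqrt_pos.2 hn'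
  have hss : Real.sqrt n ^ 2 = n := Real.sq_sqrt hn'.le
  have hc : 0 < Real.sqrt (ε / (2 * Real.sqrt n)) := by positivity
  have hc2 : Real.sqrt (ε / (2 * Real.sqrt n)) ^ 2 = ε / (2 * Real.sqrt n) :=
    Real.sq_sqrt (by positivity)
  have h := measure_abs_average_sub_one_le hf hf2 hf1 hn0 hc
  have hval : Var[f; μ] / (n * (ε / (2 * Real.sqrt n))) = 2 * Var[f; μ] / ε / Real.sqrt n := by
    rw [← hss]
    field_simp
    rw [Real.sqrt_sq hsn.le]
  rw [hc2, hval] at h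
  refine (measure_mono fun ω hω => ?_).trans h
  simp only [mem_ofPred_eq, Pi.zero_apply, sub_zero, norm_mul, Real.norm_eq_abs,
    abs_of_pos hsn] at hω ⊢
  by_contra! hlt
  set x := (∑ k ∈ Finset.range n, f (ω k)) / n
  have hsq : (x - 1) ^ 2 < ε / (2 * Real.sqrt n) := by
    rw [← hc2, ← sq_abs]
    gcongr
  have hquarter : ε / (2 * Real.sqrt n) ≤ (1 / 2) ^ 2 := by
    rw [div_le_iff₀ (by positivity)]
    linarith
  have hhalf : |x - 1| ≤ 1 / 2 := abs_le_of_sq_le_sq (hsq.le.trans hquarter) (by norm_num)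
  have h5 := abs_log_sub_le hhalf
  have h6 : Real.sqrt n * |Real.log x - (x - 1)| < ε := by
    calc _ ≤ Real.sqrt n * (2 * (x - 1) ^ 2) := by gcongr
      _ < Real.sqrt n * (2 * (ε / (2 * Real.sqrt n))) := by gcongr
      _ = ε := by field_simp
  linarith

lemma TendstoInMeasure.const_mul_sub_const_mul {Ω : Type*} {mΩ : MeasurableSpace Ω}
    {P : Measure Ω} {F G : ℕ → Ω → ℝ} (hF : TendstoInMeasure P F atTop 0)
    (hG : TendstoInMeasure P G atTop 0) (a b : ℝ) :
    TendstoInMeasure P (fun n ω => a * F n ω - b * G n ω) atTop 0 := by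
  rw [tendstoInMeasure_iff_norm] at hF hG ⊢
  intro ε hε
  have hδ : 0 < ε / (|a| + |b| + 1) := by positivity
  have hlim := (hF _ hδ).add (hG _ hδ)
  rw [add_zero] at hlim
  refine tendsto_of_tendsto_of_tendsto_of_le_of_le tendsto_const_nhds hlim
    (fun _ => zero_le) fun n => ?_
  refine (measure_mono fun ω hω => ?_).trans (measure_union_le _ _)
  simp only [mem_union, mem_ofPred_eq, Pi.zero_apply, sub_zero, Real.norm_eq_abs] at hω ⊢
  by_contra! hlt
  have h1 : |a * F n ω - b * G n ω| ≤ |a| * |F n ω| + |b| * |G n ω| := by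
    rw [← abs_mul, ← abs_mul]
    exact abs_sub _ _
  have h2 : |a| * |F n ω| + |b| * |G n ω| ≤
      (|a| + |b|) * (ε / (|a| + |b| + 1)) := by
    rw [add_mul]
    gcongr
    exacts [hlt.1.le, hlt.2.le]
  have h3 : (|a| + |b| + 1) * (ε / (|a| + |b| + 1)) = ε := by field_simp
  linarith

/-- Convergence of distribution functions in the central limit theorem, after linearizing a
difference of logarithms of averages. -/
lemma tendsto_cdf_log_averages {f g : ℝ → ℝ} (hf : Measurable f) (hg : Measurable g)
    (hf2 : MemLp f 2 μ) (hg2 : MemLp g 2 μ) (hf1 : ∫ x, f x ∂μ = 1) (hg1 : ∫ x, g x ∂μ = 1)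
    (a b : ℝ) {v : ℝ} (hv : v = Var[fun x => a * f x - b * g x; μ]) (hvpos : 0 < v) (x : ℝ) :
    Tendsto (fun n : ℕ => (Measure.infinitePi (fun _ : ℕ => μ) {ω | Real.sqrt n *
      (a * Real.log ((∑ k ∈ Finset.range n, f (ω k)) / n) -
        b * Real.log ((∑ k ∈ Finset.range n, g (ω k)) / n)) ≤ x}).toReal)
      atTop (𝓝 (gaussCDF v x)) := by
  have hw : Measurable fun x => a * f x - b * g x := by fun_prop
  have hw2 : MemLp (fun x => a * f x - b * g x) 2 μ := (hf2.const_mul a).sub (hg2.const_mul b)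
  have hw1 : ∫ x, (a * f x - b * g x) ∂μ = a - b := by
    rw [integral_sub ((hf2.integrable (by norm_num)).const_mul a)
      ((hg2.integrable (by norm_num)).const_mul b), integral_const_mul, integral_const_mul,
      hf1, hg1, mul_one, mul_one]
  have hclt := tendstoInDistribution_inv_sqrt_mul_sum_sub (P := Measure.infinitePi fun _ : ℕ => μ)
    (X := fun k ω => a * f (ω k) - b * g (ω k)) (Y := id) (P' := gaussianReal 0 v.toNNReal)
    (by rw [(identDistrib_infinitePi_eval hw 0).variance_eq, ← hv]; exact HasLaw.id)
    (memLp_infinitePi_eval hw hw2 0) (iIndepFun_infinitePi_eval hw)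
    fun i => (identDistrib_infinitePi_eval hw i).trans (identDistrib_infinitePi_eval hw 0).symm
  rw [(identDistrib_infinitePi_eval hw 0).integral_eq, hw1] at hclt
  have hrem := TendstoInMeasure.const_mul_sub_const_mul (tendstoInMeasure_log_average hf hf2 hf1)
    (tendstoInMeasure_log_average hg hg2 hg1) a b
  have hT := tendstoInDistribution_of_tendstoInMeasure_sub (fun (n : ℕ) ω => Real.sqrt n *
      (a * Real.log ((∑ k ∈ Finset.range n, f (ω k)) / n) -
        b * Real.log ((∑ k ∈ Finset.range n, g (ω k)) / n))) _ hclt ?_ ?_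
  · have := ProbabilityMeasure.tendsto_measure_of_null_frontier_of_tendsto' hT.tendsto
      (E := Iic x) ?_
    · simp only [ProbabilityMeasure.coe_mk, Measure.map_id] at this
      have h2 := (ENNReal.tendsto_toReal (measure_ne_top _ _)).comp this
      refine h2.congr fun n => ?_
      simp only [Function.comp]
      rw [Measure.map_apply_of_aemeasurable (hT.forall_aemeasurable n) measurableSet_Iic]
      rfl
    · have := nullSingletonClass_gaussianReal (μ := 0) (Real.toNNReal_pos.2 hvpos).ne'
      simp
  · refine hrem.congr_left fun n => .of_forall fun ω => ?_
    rcases eq_or_ne n 0 with rfl | hn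
    · simp
    have hn' : (0 : ℝ) < n := by exact_mod_cast Nat.pos_of_ne_zero hn
    have hsn : 0 < Real.sqrt n := Real.sqrt_pos.2 hn'
    have hinv : (Real.sqrt n)⁻¹ = Real.sqrt n / n := by
      rw [Real.sqrt_div_self', one_div]
    simp only [Pi.sub_apply, Finset.sum_sub_distrib, ← Finset.mul_sum, hinv]
    field_simp
    ring
  · intro n
    fun_prop

end IID

section Moments

open ProbabilityTheory

lemma memLp_two_abs_rpow_pGauss {p s : ℝ} (hp : 0 < p) (hs : 0 ≤ s) :
    MemLp (fun x => |x| ^ s) 2 (pGauss p) := by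
  rw [memLp_two_iff_integrable_sq (by fun_prop)]
  refine (integrable_abs_rpow_pGauss hp (show 0 ≤ s + s by linarith)).congr (.of_forall fun x => ?_)
  simp only
  rw [Real.rpow_add_of_nonneg (abs_nonneg _) hs hs, sq]

lemma memLp_two_abs_rpow_div_pGauss {p s : ℝ} (hp : 0 < p) (hs : 0 ≤ s) (c : ℝ) :
    MemLp (fun x => |x| ^ s / c) 2 (pGauss p) := by
  simp_rw [div_eq_inv_mul]
  exact (memLp_two_abs_rpow_pGauss hp hs).const_mul _

lemma integral_mul_abs_rpow_pGauss {p s r : ℝ} (hp : 0 < p) (hs : 0 ≤ s) (hr : 0 ≤ r) :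
    ∫ x, |x| ^ s * |x| ^ r ∂(pGauss p) = Mp p (s + r) := by
  rw [← integral_abs_rpow_pGauss hp (show 0 ≤ s + r by linarith)]
  refine integral_congr_ae (.of_forall fun x => ?_)
  simp only
  rw [Real.rpow_add_of_nonneg (abs_nonneg _) hs hr]

lemma covariance_abs_rpow_pGauss {p s r : ℝ} (hp : 0 < p) (hs : 0 ≤ s) (hr : 0 ≤ r) :
    cov[fun x => |x| ^ s, fun x => |x| ^ r; pGauss p] = Cp p s r := by
  have := isProbabilityMeasure_pGauss hp
  rw [covariance_eq_sub (memLp_two_abs_rpow_pGauss hp hs) (memLp_two_abs_rpow_pGauss hp hr),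
    integral_abs_rpow_pGauss hp hs, integral_abs_rpow_pGauss hp hr]
  simp only [Pi.mul_apply]
  rw [integral_mul_abs_rpow_pGauss hp hs hr, Cp]

/-- The variance of the linearized log-ratio of norms. -/
lemma sigmaSq_eq_variance {p q : ℝ} (hp : 0 < p) (hq : 0 < q) :
    sigmaSq p q =
      Var[fun x => 1 / q * (|x| ^ q / Mp p q) - 1 / p * |x| ^ p; pGauss p] := by
  have := isProbabilityMeasure_pGauss hp
  have hM := Mp_pos hp hq.le
  have hcq := memLp_two_abs_rpow_pGauss hp hq.le
  have hcp := memLp_two_abs_rpow_pGauss hp hp.le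
  have h : (fun x : ℝ => 1 / q * (|x| ^ q / Mp p q) - 1 / p * |x| ^ p) =
      (fun x => (1 / (q * Mp p q)) * |x| ^ q) - fun x => 1 / p * |x| ^ p := by
    ext x
    simp only [Pi.sub_apply]
    field_simp
  rw [h, variance_sub (hcq.const_mul _) (hcp.const_mul _), variance_const_mul, variance_const_mul,
    covariance_const_mul_left, covariance_const_mul_right,
    ← covariance_self (by fun_prop), ← covariance_self (by fun_prop),
    covariance_abs_rpow_pGauss hp hq.le hq.le, covariance_abs_rpow_pGauss hp hp.le hp.le,
    covariance_abs_rpow_pGauss hp hq.le hp.le, sigmaSq]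
  have hc : Cp p q p = Cp p p q := by
    unfold Cp
    rw [add_comm q p, mul_comm (Mp p q)]
  rw [hc]
  field_simp

lemma volume_absolutelyContinuous_pGauss {p : ℝ} (hp : 0 < p) : volume ≪ pGauss p := by
  have hc := pGaussConst_pos hp
  refine withDensity_absolutelyContinuous' (by fun_prop) (.of_forall fun x => ?_)
  rw [ne_eq, ENNReal.ofReal_eq_zero, not_le]
  positivity

lemma sigmaSq_pos {p q : ℝ} (hp : 0 < p) (hq : 0 < q) (hpq : p ≠ q) : 0 < sigmaSq p q := by
  have := isProbabilityMeasure_pGauss hp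
  have hM := Mp_pos hp hq.le
  rw [sigmaSq_eq_variance hp hq]
  refine (variance_nonneg _ _).lt_of_ne fun h0 => hpq ?_
  have hmem : MemLp (fun x => 1 / q * (|x| ^ q / Mp p q) - 1 / p * |x| ^ p) 2 (pGauss p) :=
    ((memLp_two_abs_rpow_div_pGauss hp hq.le _).const_mul _).sub
      ((memLp_two_abs_rpow_pGauss hp hp.le).const_mul _)
  have hae := (volume_absolutelyContinuous_pGauss hp).ae_le
    (ae_eq_integral_of_variance_eq_zero hmem h0.symm)
  have hcont : ∀ s : ℝ, 0 < s → Continuous fun x : ℝ => |x| ^ s := fun s hs =>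
    continuous_abs.rpow_const fun _ => .inr hs.le
  have heq := (Continuous.ae_eq_iff_eq (μ := (volume : Measure ℝ))
    ((continuous_const.mul ((hcont q hq).div_const _)).sub (continuous_const.mul (hcont p hp)))
    continuous_const).1 hae
  set c := ∫ x, (1 / q * (|x| ^ q / Mp p q) - 1 / p * |x| ^ p) ∂(pGauss p)
  have e0 : 1 / q * (|(0 : ℝ)| ^ q / Mp p q) - 1 / p * |(0 : ℝ)| ^ p = c := congrFun heq 0
  have e1 : 1 / q * (|(1 : ℝ)| ^ q / Mp p q) - 1 / p * |(1 : ℝ)| ^ p = c := congrFun heq 1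
  have e2 : 1 / q * (|(2 : ℝ)| ^ q / Mp p q) - 1 / p * |(2 : ℝ)| ^ p = c := congrFun heq 2
  simp only [abs_zero, abs_one, Real.one_rpow, Real.zero_rpow hp.ne', Real.zero_rpow hq.ne',
    zero_div, mul_zero, sub_zero, mul_one] at e0 e1 e2
  rw [← e0] at e1 e2
  rw [abs_of_pos two_pos] at e2
  have h12 : (1 / p) * ((2 : ℝ) ^ q - 2 ^ p) = 0 := by
    have : 1 / q * ((2 : ℝ) ^ q / Mp p q) = (1 / q * (1 / Mp p q)) * 2 ^ q := by ring
    rw [this] at e2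
    have e1' : 1 / q * (1 / Mp p q) = 1 / p := by linarith
    rw [e1'] at e2
    linarith
  have h2 : (2 : ℝ) ^ p = 2 ^ q := by
    rcases mul_eq_zero.1 h12 with h | h
    · exact absurd h (by positivity)
    · linarith
  exact (Real.strictMono_rpow_of_base_gt_one one_lt_two).injective h2

lemma pnorm_le_mul_pnorm_iff {p q s : ℝ} (hp : 0 < p) (hq : 0 < q) {n : ℕ} (hn : n ≠ 0)
    (hs : 0 < s) {x : Fin n → ℝ} (hx : x ≠ 0) :
    pnorm q x ≤ s * pnorm p x ↔
      1 / q * Real.log ((∑ i, |x i| ^ q / Mp p q) / n) - 1 / p * Real.log ((∑ i, |x i| ^ p) / n) ≤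
        Real.log (s * (n : ℝ) ^ (1 / p - 1 / q) / mpq p q) := by
  have hn' : (0 : ℝ) < n := by exact_mod_cast Nat.pos_of_ne_zero hn
  have hM := Mp_pos hp hq.le
  have hm := mpq_pos hp hq
  obtain ⟨i, hi⟩ : ∃ i, x i ≠ 0 := Function.ne_iff.1 hx
  have hsum : ∀ r : ℝ, 0 < ∑ i, |x i| ^ r := fun r =>
    Finset.sum_pos' (fun j _ => by positivity) ⟨i, Finset.mem_univ i, by positivity⟩
  have hSq := hsum q
  have hSp := hsum p
  rw [← Finset.sum_div, pnorm, pnorm, ← Real.log_le_log_iff (by positivity) (by positivity),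
    Real.log_mul hs.ne' (by positivity), Real.log_rpow hSq, Real.log_rpow hSp,
    Real.log_div (by positivity) hn'.ne', Real.log_div hSq.ne' hM.ne',
    Real.log_div hSp.ne' hn'.ne', Real.log_div (by positivity) hm.ne',
    Real.log_mul hs.ne' (by positivity), Real.log_rpow hn', mpq, Real.log_rpow hM]
  constructor <;> intro h <;> linarith

lemma map_infinitePi_pGauss {p : ℝ} (hp : 0 < p) (n : ℕ) :
    (Measure.infinitePi fun _ : ℕ => pGauss p).map (fun ω (i : Fin n) => ω i) =
      pGaussPi p n := by
  have := isProbabilityMeasure_pGauss hp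
  rw [pGaussPi, ← Measure.infinitePi_eq_pi]
  exact Measure.map_infinitePi_infinitePi_of_inj (P := fun _ => pGauss p) Fin.val_injective

lemma coneProb_eq_log_averages {p q s : ℝ} (hp : 0 < p) (hq : 0 < q) {n : ℕ} (hn : n ≠ 0)
    (hs : 0 < s) :
    coneProb p q n s = (Measure.infinitePi (fun _ : ℕ => pGauss p) {ω | Real.sqrt n *
      (1 / q * Real.log ((∑ k ∈ Finset.range n, |ω k| ^ q / Mp p q) / n) -
        1 / p * Real.log ((∑ k ∈ Finset.range n, |ω k| ^ p) / n)) ≤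
          Real.sqrt n * Real.log (s * (n : ℝ) ^ (1 / p - 1 / q) / mpq p q)}).toReal := by
  have := isProbabilityMeasure_pGauss hp
  have hn' : (0 : ℝ) < n := by exact_mod_cast Nat.pos_of_ne_zero hn
  rw [coneProb, ← map_infinitePi_pGauss hp, Measure.map_apply (by fun_prop)
    (measurableSet_le (measurable_pnorm q n) ((measurable_pnorm p n).const_mul s))]
  congr 1
  have h0 : ∀ᵐ ω ∂(Measure.infinitePi fun _ : ℕ => pGauss p), ω 0 ≠ 0 := by
    rw [ae_iff]
    have h := (measurePreserving_eval_infinitePi (fun _ : ℕ => pGauss p) 0).measure_preimage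
      (measurableSet_singleton (0 : ℝ)).nullMeasurableSet
    rw [pGauss_singleton] at h
    rw [← h]
    congr 1
    ext ω
    simp
  refine measure_congr ?_
  filter_upwards [h0] with ω hω
  have hx : (fun i : Fin n => ω i) ≠ 0 := fun h =>
    hω (congrFun h ⟨0, Nat.pos_of_ne_zero hn⟩)
  refine propext ?_
  change pnorm q (fun i : Fin n => ω i) ≤ s * pnorm p (fun i : Fin n => ω i) ↔ _ ≤ _
  rw [pnorm_le_mul_pnorm_iff hp hq hn hs hx, mul_le_mul_iff_right₀ (Real.sqrt_pos.2 hn'),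
    Finset.sum_range, Finset.sum_range]

/-- The limit law of the rescaled log-ratio of norms, in terms of `coneProb`. -/
lemma exists_cdf_coneProb {p q : ℝ} (hp : 0 < p) (hq : 0 < q) (hpq : p ≠ q) :
    ∃ G : ℕ → ℝ → ℝ, (∀ n, Monotone (G n)) ∧ (∀ n x, 0 ≤ G n x) ∧ (∀ n x, G n x ≤ 1) ∧
      (∀ x, Tendsto (fun n => G n x) atTop (𝓝 (gaussCDF (sigmaSq p q) x))) ∧
      ∀ n : ℕ, n ≠ 0 → ∀ s : ℝ, 0 < s → coneProb p q n s =
        G n (Real.sqrt n * Real.log (s * (n : ℝ) ^ (1 / p - 1 / q) / mpq p q)) := by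
  have := isProbabilityMeasure_pGauss hp
  have hM := Mp_pos hp hq.le
  refine ⟨fun n x => (Measure.infinitePi (fun _ : ℕ => pGauss p) {ω | Real.sqrt n *
      (1 / q * Real.log ((∑ k ∈ Finset.range n, |ω k| ^ q / Mp p q) / n) -
        1 / p * Real.log ((∑ k ∈ Finset.range n, |ω k| ^ p) / n)) ≤ x}).toReal,
    fun n x y hxy => ENNReal.toReal_mono (measure_ne_top _ _)
      (measure_mono fun ω (hω : _ ≤ x) => hω.trans hxy),
    fun n x => ENNReal.toReal_nonneg, fun n x => measureReal_le_one, fun x => ?_,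
    fun n hn s hs => coneProb_eq_log_averages hp hq hn hs⟩
  refine tendsto_cdf_log_averages (f := fun x => |x| ^ q / Mp p q) (g := fun x => |x| ^ p)
    (by fun_prop) (by fun_prop) (memLp_two_abs_rpow_div_pGauss hp hq.le _)
    (memLp_two_abs_rpow_pGauss hp hp.le) ?_ ?_ _ _ (sigmaSq_eq_variance hp hq)
    (sigmaSq_pos hp hq hpq) x
  · rw [integral_div, integral_abs_rpow_pGauss hp hq.le, div_self hM.ne']
  · rw [integral_abs_rpow_pGauss hp hp.le, Mp_self hp]

lemma dilation_mul_rpow_div_mpq {p q t : ℝ} {n : ℕ} (hn : n ≠ 0) :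
    dilation p q n t * (n : ℝ) ^ (1 / p - 1 / q) / mpq p q = t * Apqn p q n := by
  have hn' : (0 : ℝ) < n := by exact_mod_cast Nat.pos_of_ne_zero hn
  rw [dilation, Apqn, kpn, kpn, Real.rpow_sub hn']
  simp only [div_eq_mul_inv, mul_inv]
  ring

end Moments

section Limit

open ProbabilityTheory

lemma gaussCDF_eq_cdf (v x : ℝ) : gaussCDF v x = cdf (gaussianReal 0 v.toNNReal) x :=
  (cdf_eq_real _ _).symm

lemma gaussCDFE_coe (v x : ℝ) : gaussCDFE v (x : EReal) = gaussCDF v x := by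
  simp [gaussCDFE]

lemma continuous_gaussCDF {v : ℝ} (hv : 0 < v) : Continuous (gaussCDF v) := by
  have hatom := nullSingletonClass_gaussianReal (μ := 0) (Real.toNNReal_pos.2 hv).ne'
  have hfun : gaussCDF v = cdf (gaussianReal 0 v.toNNReal) := funext fun x => gaussCDF_eq_cdf v x
  rw [hfun, continuous_iff_continuousAt]
  intro x
  rw [(monotone_cdf _).continuousAt_iff_leftLim_eq_rightLim, StieltjesFunction.rightLim_eq]
  have h := StieltjesFunction.measure_singleton (cdf (gaussianReal 0 v.toNNReal)) x
  rw [measure_cdf, measure_singleton, eq_comm, ENNReal.ofReal_eq_zero] at h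
  exact le_antisymm ((monotone_cdf _).leftLim_le le_rfl) (by linarith)

lemma exists_lt_gaussCDF {v c : ℝ} (hv : 0 < v) {L : EReal} (hc : c < gaussCDFE v L)
    (hc0 : 0 ≤ c) : ∃ x : ℝ, (x : EReal) < L ∧ c < gaussCDF v x := by
  induction L with
  | bot => simp [gaussCDFE] at hc; linarith
  | top =>
    have h := tendsto_cdf_atTop (gaussianReal 0 v.toNNReal)
    simp only [gaussCDFE, top_ne_bot, if_false, if_true] at hc
    obtain ⟨x, hx⟩ := (h.eventually_const_lt hc).exists
    exact ⟨x, EReal.coe_lt_top x, by rwa [gaussCDF_eq_cdf]⟩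
  | coe y =>
    rw [gaussCDFE_coe] at hc
    have h := (continuous_gaussCDF hv).continuousAt.eventually_const_lt hc
    obtain ⟨x, hx, hxy⟩ := ((h.filter_mono nhdsWithin_le_nhds).and
      (self_mem_nhdsWithin (s := Iio y))).exists
    exact ⟨x, EReal.coe_lt_coe_iff.2 hxy, hx⟩

lemma exists_gaussCDF_lt {v c : ℝ} (hv : 0 < v) {L : EReal} (hc : gaussCDFE v L < c)
    (hc1 : c ≤ 1) : ∃ x : ℝ, L < (x : EReal) ∧ gaussCDF v x < c := by
  induction L with
  | top => simp [gaussCDFE] at hc; linarith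
  | bot =>
    have h := tendsto_cdf_atBot (gaussianReal 0 v.toNNReal)
    simp only [gaussCDFE, if_true] at hc
    obtain ⟨x, hx⟩ := (h.eventually_lt_const hc).exists
    exact ⟨x, EReal.bot_lt_coe x, by rwa [gaussCDF_eq_cdf]⟩
  | coe y =>
    rw [gaussCDFE_coe] at hc
    have h := (continuous_gaussCDF hv).continuousAt.eventually_lt_const hc
    obtain ⟨x, hx, hxy⟩ := ((h.filter_mono nhdsWithin_le_nhds).and
      (self_mem_nhdsWithin (s := Ioi y))).exists
    exact ⟨x, EReal.coe_lt_coe_iff.2 hxy, hx⟩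

lemma tendsto_gaussCDFE_of_sandwich {v : ℝ} (hv : 0 < v) {G : ℕ → ℝ → ℝ}
    (hmono : ∀ n, Monotone (G n)) (hG0 : ∀ n x, 0 ≤ G n x) (hG1 : ∀ n x, G n x ≤ 1)
    (hG : ∀ x, Tendsto (fun n => G n x) atTop (𝓝 (gaussCDF v x))) {a l u ε : ℕ → ℝ}
    (hl : ∀ᶠ n in atTop, G n (l n) ≤ a n) (hu : ∀ᶠ n in atTop, a n ≤ ε n + G n (u n))
    (hε : Tendsto ε atTop (𝓝 0)) {L : EReal}
    (hlL : Tendsto (fun n => (l n : EReal)) atTop (𝓝 L))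
    (huL : Tendsto (fun n => (u n : EReal)) atTop (𝓝 L)) :
    Tendsto a atTop (𝓝 (gaussCDFE v L)) := by
  refine tendsto_order.2 ⟨fun c hc => ?_, fun c hc => ?_⟩
  · rcases lt_or_ge c 0 with hc0 | hc0
    · filter_upwards [hl] with n hn
      exact hc0.trans_le ((hG0 n _).trans hn)
    · obtain ⟨x, hxL, hcx⟩ := exists_lt_gaussCDF hv hc hc0
      filter_upwards [hl, hlL.eventually_const_lt hxL, (hG x).eventually_const_lt hcx]
        with n h1 h2 h3
      exact h3.trans_le ((hmono n (EReal.coe_lt_coe_iff.1 h2).le).trans h1)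
  · rcases lt_or_ge 1 c with hc1 | hc1
    · filter_upwards [hu, hε.eventually_lt_const (sub_pos.2 hc1)] with n h1 h2
      linarith [hG1 n (u n)]
    · obtain ⟨x, hxL, hcx⟩ := exists_gaussCDF_lt hv hc hc1
      have h := hε.add (hG x)
      rw [zero_add] at h
      filter_upwards [hu, huL.eventually_lt_const hxL, h.eventually_lt_const hcx] with n h1 h2 h3
      linarith [hmono n (EReal.coe_lt_coe_iff.1 h2).le]

lemma tendsto_sqrt_mul_log_one_add_div (y : ℝ) :
    Tendsto (fun n : ℕ => Real.sqrt n * Real.log (1 + y / Real.sqrt n)) atTop (𝓝 y) :=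
  (Real.tendsto_mul_log_one_add_div_atTop y).comp
    (Real.tendsto_sqrt_atTop.comp tendsto_natCast_atTop_atTop)

lemma tendsto_sqrt_mul_log {s : ℕ → ℝ} (hs : ∀ n, 0 < s n) {L : EReal}
    (h : Tendsto (fun n : ℕ => ((Real.sqrt n * (s n - 1) : ℝ) : EReal)) atTop (𝓝 L)) :
    Tendsto (fun n : ℕ => ((Real.sqrt n * Real.log (s n) : ℝ) : EReal)) atTop (𝓝 L) := by
  have hsqrt : Tendsto (fun n : ℕ => Real.sqrt n) atTop atTop :=
    Real.tendsto_sqrt_atTop.comp tendsto_natCast_atTop_atTop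
  refine tendsto_order.2 ⟨fun c hc => ?_, fun c hc => ?_⟩
  · obtain ⟨y, hcy, hyL⟩ := EReal.lt_iff_exists_real_btwn.1 hc
    have h1 := ((continuous_coe_real_ereal.tendsto y).comp
      (tendsto_sqrt_mul_log_one_add_div y)).eventually_const_lt hcy
    filter_upwards [h1, h.eventually_const_lt hyL, hsqrt.eventually_gt_atTop |y|] with n h1 h2 h3
    have hn : 0 < Real.sqrt n := (abs_nonneg y).trans_lt h3
    have h4 : 0 < 1 + y / Real.sqrt n := by
      have : -1 < y / Real.sqrt n := by
        rw [lt_div_iff₀ hn]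
        linarith [neg_abs_le y]
      linarith
    have h5 : y < Real.sqrt n * (s n - 1) := EReal.coe_lt_coe_iff.1 h2
    have h6 : 1 + y / Real.sqrt n ≤ s n := by
      have : y / Real.sqrt n < s n - 1 := by
        rw [div_lt_iff₀ hn]
        linarith
      linarith
    exact h1.trans_le (EReal.coe_le_coe_iff.2
      (mul_le_mul_of_nonneg_left (Real.log_le_log h4 h6) hn.le))
  · obtain ⟨y, hyL, hcy⟩ := EReal.lt_iff_exists_real_btwn.1 hc
    have h1 := ((continuous_coe_real_ereal.tendsto y).comp
      (tendsto_sqrt_mul_log_one_add_div y)).eventually_lt_const hcy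
    filter_upwards [h1, h.eventually_lt_const hyL, hsqrt.eventually_gt_atTop 0] with n h1 h2 hn
    have h5 : Real.sqrt n * (s n - 1) < y := EReal.coe_lt_coe_iff.1 h2
    have h6 : s n ≤ 1 + y / Real.sqrt n := by
      have : s n - 1 < y / Real.sqrt n := by
        rw [lt_div_iff₀ hn]
        linarith
      linarith
    exact (EReal.coe_le_coe_iff.2
      (mul_le_mul_of_nonneg_left (Real.log_le_log (hs n) h6) hn.le)).trans_lt h1

lemma tendsto_coe_add_of_tendsto_zero {a d : ℕ → ℝ} {L : EReal}
    (ha : Tendsto (fun n => (a n : EReal)) atTop (𝓝 L)) (hd : Tendsto d atTop (𝓝 0)) :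
    Tendsto (fun n => ((a n + d n : ℝ) : EReal)) atTop (𝓝 L) := by
  have hd' : Tendsto (fun n => (d n : EReal)) atTop (𝓝 ((0 : ℝ) : EReal)) :=
    (continuous_coe_real_ereal.tendsto 0).comp hd
  have h := (EReal.continuousAt_add (p := (L, ((0 : ℝ) : EReal))) (.inr (EReal.coe_ne_bot 0))
    (.inr (EReal.coe_ne_top 0))).tendsto.comp (ha.prodMk_nhds hd')
  simpa [Function.comp_def] using h

/-- The limit of `|𝔻_p^n ∩ t_n 𝔻_q^n|` is the value at `lim √n (t_n A_{p,q} − 1)` of the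
distribution function of the Gaussian with variance `σ²_{p,q}`. -/
lemma tendsto_volume_nBall_inter {p q A : ℝ} (hp : 0 < p) (hq : 0 < q) (hpq : p ≠ q)
    (hA : Tendsto (fun n : ℕ => Apqn p q n) atTop (𝓝 A)) (hApos : 0 < A)
    {t : ℕ → ℝ} (ht : ∀ n, 0 < t n) {L : EReal}
    (hL : Tendsto (fun n : ℕ => ((Real.sqrt n * (t n * A - 1) : ℝ) : EReal)) atTop (𝓝 L)) :
    Tendsto (fun n : ℕ => (volume (nBall n p ∩ t n • nBall n q)).toReal) atTop
      (𝓝 (gaussCDFE (sigmaSq p q) L)) := by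
  obtain ⟨G, hmono, hG0, hG1, hG, hcone⟩ := exists_cdf_coneProb hp hq hpq
  have hlog : Tendsto (fun n : ℕ => ((Real.sqrt n * Real.log (t n * Apqn p q n) : ℝ) : EReal))
      atTop (𝓝 L) := by
    have h := tendsto_coe_add_of_tendsto_zero
      (tendsto_sqrt_mul_log (fun n => mul_pos (ht n) hApos) hL)
      (tendsto_sqrt_mul_log_Apqn hp hq hA hApos)
    refine h.congr' ?_
    filter_upwards [eventually_ne_atTop 0] with n hn
    rw [Real.log_mul (ht n).ne' hApos.ne', Real.log_mul (ht n).ne' (Apqn_pos hp hq hn).ne']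
    congr 1
    ring
  have hpow : Tendsto (fun n : ℕ => (n : ℝ) ^ (1 / 4 : ℝ)) atTop atTop :=
    (tendsto_rpow_atTop (by norm_num)).comp tendsto_natCast_atTop_atTop
  have hlog' := tendsto_coe_add_of_tendsto_zero hlog hpow.inv_tendsto_atTop
  have hε := Real.tendsto_exp_neg_atTop_nhds_zero.comp hpow
  refine tendsto_gaussCDFE_of_sandwich (sigmaSq_pos hp hq hpq) hmono hG0 hG1 hG ?_ ?_ hε hlog hlog'
  · filter_upwards [eventually_ne_atTop 0] with n hn
    have h := coneProb_le_volume hp hq hn (ht n)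
    rwa [hcone n hn _ (dilation_pos hp hq n (ht n)), dilation_mul_rpow_div_mpq hn] at h
  · filter_upwards [eventually_ne_atTop 0] with n hn
    have hn' : (0 : ℝ) < n := by exact_mod_cast Nat.pos_of_ne_zero hn
    set w := (n : ℝ) ^ (1 / 4 : ℝ) with hw
    have hwpos : 0 < w := by positivity
    have hw2 : Real.sqrt n = w ^ 2 := by
      rw [hw, ← Real.rpow_natCast, ← Real.rpow_mul hn'.le, Real.sqrt_eq_rpow]
      norm_num
    have hw4 : (n : ℝ) = w ^ 4 := by
      rw [hw, ← Real.rpow_natCast, ← Real.rpow_mul hn'.le]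
      norm_num
    have hκ : 0 < Real.exp (w ^ 3)⁻¹ := Real.exp_pos _
    have hd := dilation_pos hp hq n (ht n)
    have h := volume_le_coneProb hp hq hn (ht n) hκ
    have hA' := Apqn_pos hp hq hn
    have ht' := ht n
    rw [hcone n hn _ (mul_pos hκ hd), mul_assoc, mul_div_assoc, dilation_mul_rpow_div_mpq hn,
      Real.log_mul hκ.ne' (by positivity), Real.log_exp, ← Real.exp_neg, ← Real.exp_nat_mul] at h
    have e1 : (n : ℝ) * -(w ^ 3)⁻¹ = -w := by
      rw [hw4]
      field_simp
    have e2 : Real.sqrt n * ((w ^ 3)⁻¹ + Real.log (t n * Apqn p q n)) =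
        Real.sqrt n * Real.log (t n * Apqn p q n) + w⁻¹ := by
      rw [hw2]
      field_simp
      ring
    rw [e1, e2] at h
    exact h

lemma gaussCDF_zero {v : ℝ} (hv : 0 < v) : gaussCDF v 0 = 1 / 2 := by
  have hatom := nullSingletonClass_gaussianReal (μ := 0) (Real.toNNReal_pos.2 hv).ne'
  set γ := gaussianReal 0 v.toNNReal with hγ
  have hneg : γ.real (Iic 0) = γ.real (Ici 0) := by
    have h : γ.map (fun x => -x) = γ := by rw [hγ, gaussianReal_map_neg, neg_zero]
    have h2 : γ.map (fun x => -x) (Iic 0) = γ (Ici 0) := by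
      rw [Measure.map_apply measurable_neg measurableSet_Iic]
      congr 1
      ext x
      simp
    rw [h] at h2
    simp [Measure.real, h2]
  have hIoi : γ.real (Ici 0) = γ.real (Ioi 0) := measureReal_congr Ioi_ae_eq_Ici.symm
  have hcompl : γ.real (Ioi 0) = 1 - γ.real (Iic 0) := by
    rw [← compl_Iic, probReal_compl_eq_one_sub measurableSet_Iic]
  change γ.real (Iic 0) = 1 / 2
  linarith

end Limit

/-- Asymptotic volume of intersections of normalized `ℓ_p^n`-balls
(Schechtman–Schmuckenschläger type result): if `√n (t_n A_{p,q} − 1) → Φ_{p,q}^{-1}(r)`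
in `[−∞,∞]`, then `|𝔻_p^n ∩ t_n 𝔻_q^n| → r`; in particular, for a constant dilation
factor `t` the limit is `0`, `1/2` or `1` according to whether `t` is smaller than,
equal to, or bigger than `1/A_{p,q}`. -/
theorem volume_intersection_lp_balls (p q : ℝ) (hp : 0 < p) (hq : 0 < q) (hpq : p ≠ q)
    (A : ℝ) (hA : Tendsto (fun n : ℕ => Apqn p q n) atTop (𝓝 A)) (hApos : 0 < A) :
    (∀ r ∈ Icc (0 : ℝ) 1, ∀ t : ℕ → ℝ, (∀ n, 0 < t n) →
      (∃ L : EReal,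
        Tendsto (fun n : ℕ => ((Real.sqrt n * (t n * A - 1) : ℝ) : EReal)) atTop (𝓝 L) ∧
          gaussCDFE (sigmaSq p q) L = r) →
      Tendsto (fun n : ℕ => (volume (nBall n p ∩ t n • nBall n q)).toReal) atTop (𝓝 r)) ∧
    (∀ t : ℝ, 0 < t →
      ((t < 1 / A →
        Tendsto (fun n : ℕ => (volume (nBall n p ∩ t • nBall n q)).toReal) atTop (𝓝 0)) ∧
       (t = 1 / A →
        Tendsto (fun n : ℕ => (volume (nBall n p ∩ t • nBall n q)).toReal) atTop
          (𝓝 (1 / 2))) ∧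
       (1 / A < t →
        Tendsto (fun n : ℕ => (volume (nBall n p ∩ t • nBall n q)).toReal) atTop
          (𝓝 1)))) := by
  have hsqrt : Tendsto (fun n : ℕ => Real.sqrt n) atTop atTop :=
    Real.tendsto_sqrt_atTop.comp tendsto_natCast_atTop_atTop
  have hmain := fun (t : ℕ → ℝ) (ht : ∀ n, 0 < t n) (L : EReal) =>
    tendsto_volume_nBall_inter hp hq hpq hA hApos ht (L := L)
  refine ⟨?_, fun t ht => ⟨fun h => ?_, fun h => ?_, fun h => ?_⟩⟩
  · rintro r - t ht ⟨L, hL, rfl⟩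
    exact hmain t ht L hL
  · rw [lt_div_iff₀ hApos] at h
    have := hmain (fun _ => t) (fun _ => ht) ⊥
      (EReal.tendsto_coe_nhds_bot_iff.2 (hsqrt.atTop_mul_const_of_neg (by linarith)))
    simpa [gaussCDFE] using this
  · have h1 : t * A - 1 = 0 := by rw [h, one_div_mul_cancel hApos.ne', sub_self]
    have := hmain (fun _ => t) (fun _ => ht) ((0 : ℝ) : EReal) (by simp [h1])
    rwa [gaussCDFE_coe, gaussCDF_zero (sigmaSq_pos hp hq hpq)] at this
  · rw [div_lt_iff₀ hApos] at h
    have := hmain (fun _ => t) (fun _ => ht) ⊤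
      (EReal.tendsto_coe_nhds_top_iff.2 (hsqrt.atTop_mul_const (by linarith)))
    simpa [gaussCDFE] using this
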